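/- Let β ∈ [0,2], assuming y_i > 0 for all i in the case β = 0, let μ* ∈ M₊(K) be a minimizer of ℓ over M₊(K), and suppose y ∉ C. Then the vector λ(μ*) has at least one strictly positive component and at least one strictly negative component. -/

import Mathlib

open MeasureTheory Real Set

noncomputable def dbeta (β u v : ℝ) : EReal :=
  if β = 0 then
    if u = 0 ∨ v = 0 then ⊤ else ((u / v - Real.log (u / v) - 1 : ℝ) : EReal)
  else if β = 1 then
    if v = 0 ∧ 0 < u then ⊤ else ((v - u - u * Real.log (v / u) : ℝ) : EReal)
  else if β < 1 then
    if v = 0 ∧ 0 < u then ⊤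
    else (((u ^ β + (β - 1) * v ^ β - β * u * v ^ (β - 1)) / (β * (β - 1)) : ℝ) : EReal)
  else (((u ^ β + (β - 1) * v ^ β - β * u * v ^ (β - 1)) / (β * (β - 1)) : ℝ) : EReal)

noncomputable def Dbeta {m : ℕ} (β : ℝ) (y w : Fin m → ℝ) : EReal :=
  ∑ i, dbeta β (y i) (w i)

noncomputable def lamvec {m : ℕ} (β : ℝ) (y w : Fin m → ℝ) : Fin m → ℝ := fun i =>
  if 0 < w i then (w i) ^ (β - 2) * (w i - y i)
  else if β = 2 then -(y i) else 0

noncomputable def Fb (β u v : ℝ) : ℝ :=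
  if β = 0 then u / v - Real.log (u / v) - 1
  else if β = 1 then v - u - u * Real.log (v / u)
  else (u ^ β + (β - 1) * v ^ β - β * u * v ^ (β - 1)) / (β * (β - 1))

def Gd (β u v : ℝ) : Prop :=
  (β = 0 → u ≠ 0 ∧ v ≠ 0) ∧ (β ≤ 1 → ¬ (v = 0 ∧ 0 < u))

lemma dbeta_good {β u v : ℝ} (h : Gd β u v) : dbeta β u v = (Fb β u v : EReal) := by
  obtain ⟨h1, h2⟩ := h
  unfold dbeta Fb
  by_cases hb0 : β = 0
  · have := h1 hb0
    simp [hb0, this.1, this.2]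
  · by_cases hb1 : β = 1
    · have := h2 hb1.le
      rw [if_neg hb0, if_pos hb1, if_neg this, if_neg hb0, if_pos hb1]
    · by_cases hb2 : β < 1
      · have := h2 hb2.le
        rw [if_neg hb0, if_neg hb1, if_pos hb2, if_neg this, if_neg hb0, if_neg hb1]
      · rw [if_neg hb0, if_neg hb1, if_neg hb2, if_neg hb0, if_neg hb1]

lemma dbeta_bad {β u v : ℝ} (hu : β = 0 → 0 < u) (h : ¬ Gd β u v) : dbeta β u v = ⊤ := by
  unfold dbeta
  by_cases hb0 : β = 0
  · rw [if_pos hb0, if_pos]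
    by_contra hc
    push Not at hc
    exact h ⟨fun _ => hc, fun _ h' => hc.2 h'.1⟩
  · have hle : β ≤ 1 ∧ (v = 0 ∧ 0 < u) := by
      by_contra hc
      exact h ⟨fun h' => absurd h' hb0, fun h1 h2 => hc ⟨h1, h2⟩⟩
    rw [if_neg hb0]
    by_cases hb1 : β = 1
    · rw [if_pos hb1, if_pos hle.2]
    · rw [if_neg hb1, if_pos (lt_of_le_of_ne hle.1 hb1), if_pos hle.2]

lemma coe_sum_real {m : ℕ} (f : Fin m → ℝ) :
    ((∑ i, f i : ℝ) : EReal) = ∑ i, (f i : EReal) := by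
  induction (Finset.univ : Finset (Fin m)) using Finset.induction_on with
  | empty => simp
  | insert a s ha ih => rw [Finset.sum_insert ha, Finset.sum_insert ha, EReal.coe_add, ih]

lemma Dbeta_good {m : ℕ} {β : ℝ} {y w : Fin m → ℝ} (h : ∀ i, Gd β (y i) (w i)) :
    Dbeta β y w = ((∑ i, Fb β (y i) (w i) : ℝ) : EReal) := by
  rw [coe_sum_real]
  exact Finset.sum_congr rfl fun i _ => dbeta_good (h i)

lemma Dbeta_bad {m : ℕ} {β : ℝ} {y w : Fin m → ℝ} (hu : β = 0 → ∀ i, 0 < y i)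
    (i : Fin m) (h : ¬ Gd β (y i) (w i)) : Dbeta β y w = ⊤ := by
  unfold Dbeta
  rw [← Finset.add_sum_erase _ _ (Finset.mem_univ i), dbeta_bad (fun h => hu h i) h]
  apply EReal.top_add_of_ne_bot
  have key : ∀ s : Finset (Fin m), ∑ j ∈ s, dbeta β (y j) (w j) ≠ ⊥ := by
    intro s
    induction s using Finset.induction_on with
    | empty => simp
    | insert a s ha ih =>
      rw [Finset.sum_insert ha]
      have : dbeta β (y a) (w a) ≠ ⊥ := by
        by_cases hg : Gd β (y a) (w a)
        · rw [dbeta_good hg]; exact EReal.coe_ne_bot _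
        · rw [dbeta_bad (fun h => hu h a) hg]; simp
      rw [Ne, EReal.add_eq_bot_iff]
      tauto
  exact key _

lemma Fb_deriv {β u v : ℝ} (hu0 : 0 ≤ u) (hu : β = 0 → 0 < u) (hv : 0 < v) :
    HasDerivAt (fun v => Fb β u v) (v ^ (β - 2) * (v - u)) v := by
  have e1 : v ^ (β - 2) = v ^ β / v ^ 2 := by
    rw [Real.rpow_sub hv]; norm_num
  by_cases hb0 : β = 0
  · have hu' := hu hb0
    have h1 : HasDerivAt (fun v : ℝ => u / v) (-u / v ^ 2) v := by
      have := (hasDerivAt_inv hv.ne').const_mul u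
      simp only [div_eq_mul_inv]
      refine this.congr_deriv ?_
      field_simp
    have h2 := (h1.sub (h1.log (by positivity))).sub_const 1
    have e : (fun v => Fb β u v) = (fun v => u / v - Real.log (u / v) - 1) := by
      funext v; simp [Fb, hb0]
    rw [e]
    refine h2.congr_deriv ?_
    rw [e1, hb0, Real.rpow_zero]
    field_simp
    ring
  · by_cases hb1 : β = 1
    · have e : (fun v => Fb β u v) = (fun v => v - u - u * Real.log (v / u)) := by
        funext v; simp [Fb, hb1]
      rw [e]
      rcases hu0.eq_or_lt with h0 | h0
      · subst h0
        simp only [sub_zero, zero_mul]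
        refine (hasDerivAt_id v).congr_deriv ?_
        rw [e1, hb1, Real.rpow_one]
        field_simp
      · have h1 := (((hasDerivAt_id v).div_const u).log (by simp; exact ⟨hv.ne', h0.ne'⟩)).const_mul u
        have h2 := ((hasDerivAt_id v).sub_const u).sub h1
        refine h2.congr_deriv ?_
        rw [e1, hb1, Real.rpow_one]
        simp only [id]
        field_simp
    · have e : (fun v => Fb β u v) = (fun v => (u ^ β + (β - 1) * v ^ β - β * u * v ^ (β - 1)) / (β * (β - 1))) := by
        funext v; simp [Fb, hb0, hb1]
      rw [e]
      have h1 := (Real.hasDerivAt_rpow_const (x := v) (p := β) (Or.inl hv.ne')).const_mul (β - 1)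
      have h2 := (Real.hasDerivAt_rpow_const (x := v) (p := β - 1) (Or.inl hv.ne')).const_mul (β * u)
      refine (((h1.const_add (u ^ β)).sub h2).div_const (β * (β - 1))).congr_deriv ?_
      have e2 : v ^ (β - 1) = v ^ β / v := by
        rw [Real.rpow_sub hv]; norm_num
      have e3 : β - 1 - 1 = β - 2 := by ring
      have hb1' : β - 1 ≠ 0 := sub_ne_zero.mpr hb1
      rw [e3, e1, e2]
      field_simp

open Filter Topology in
lemma Fb_rate_pos {β u c : ℝ} (hb : 1 < β) (hb2 : β ≤ 2) (hu : 0 < u) :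
    Tendsto (fun t : ℝ => (Fb β u (u + t * c) - Fb β u u) / t ^ (β - 1)) (𝓝[>] 0) (𝓝 0) := by
  have h0 : HasDerivAt (fun v => Fb β u v) 0 (u + 0 * c) := by
    have := Fb_deriv (β := β) hu.le (fun _ => hu) hu
    simpa using this
  have h1 : HasDerivAt (fun t : ℝ => u + t * c) (1 * c) 0 :=
    ((hasDerivAt_id (0:ℝ)).mul_const c).const_add u
  have h2 : HasDerivAt (fun t : ℝ => Fb β u (u + t * c)) (0 * (1 * c)) 0 :=
    HasDerivAt.comp (h₂ := fun v => Fb β u v) (h := fun t : ℝ => u + t * c) (0:ℝ) h0 h1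
  have h3 := h2.tendsto_slope_zero_right
  have h4 : Tendsto (fun t : ℝ => t ^ (2 - β)) (𝓝[>] 0) (𝓝 ((0:ℝ) ^ (2 - β))) :=
    ((Real.continuous_rpow_const (by linarith)).tendsto 0).mono_left nhdsWithin_le_nhds
  have h5 := h3.mul h4
  simp only [zero_mul] at h5
  refine h5.congr' ?_
  filter_upwards [self_mem_nhdsWithin] with t ht
  have ht : 0 < t := ht
  have e : t ^ (2 - β) = t / t ^ (β - 1) := by
    rw [show 2 - β = 1 - (β - 1) by ring, Real.rpow_sub ht, Real.rpow_one]
  rw [e]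
  simp only [zero_add, zero_mul, add_zero, smul_eq_mul]
  field_simp

open Filter Topology in
lemma Fb_rate_zero {β u c : ℝ} (hb : 1 < β) (hc : 0 ≤ c) :
    Tendsto (fun t : ℝ => (Fb β u (0 + t * c) - Fb β u 0) / t ^ (β - 1)) (𝓝[>] 0)
      (𝓝 (-(u * c ^ (β - 1) / (β - 1)))) := by
  have h1 : Tendsto (fun t : ℝ => t * (c ^ β / β) - u * c ^ (β - 1) / (β - 1)) (𝓝[>] 0)
      (𝓝 (0 * (c ^ β / β) - u * c ^ (β - 1) / (β - 1))) := by
    apply Tendsto.mono_left _ nhdsWithin_le_nhds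
    apply Continuous.tendsto
    fun_prop
  rw [zero_mul, zero_sub] at h1
  refine h1.congr' ?_
  filter_upwards [self_mem_nhdsWithin] with t ht
  have ht : 0 < t := ht
  have hb0 : β ≠ 0 := by linarith
  have hb1 : β ≠ 1 := hb.ne'
  have hb1' : β - 1 ≠ 0 := sub_ne_zero.mpr hb1
  have e : t ^ β = t ^ (β - 1) * t := by
    rw [← Real.rpow_add_one ht.ne']; congr 1; ring
  have hp : 0 < t ^ (β - 1) := by positivity
  simp only [Fb, if_neg hb0, if_neg hb1, zero_add, Real.zero_rpow hb0, Real.zero_rpow hb1',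
    Real.mul_rpow ht.le hc, e]
  field_simp
  ring

/-- If y ∉ C, at any minimiser μ* the vector λ(μ*) has at least one
strictly positive and at least one strictly negative component. -/
theorem stmt10 {p m : ℕ} (hp : 1 ≤ p) (hm : 1 ≤ m)
    (K : Set (EuclideanSpace ℝ (Fin p))) (hK : IsCompact K)
    (a : Fin m → C(K, ℝ)) (ha0 : ∀ i x, 0 ≤ a i x) (hane : ∀ i, ∃ x, a i x ≠ 0)
    (y : Fin m → ℝ) (hy : ∀ i, 0 ≤ y i)
    (β : ℝ) (hβ : β ∈ Icc (0:ℝ) 2)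
    (hy0 : β = 0 → ∀ i, 0 < y i)
    (C : Set (Fin m → ℝ))
    (hC : C = {w | ∃ μ : Measure K, IsFiniteMeasure μ ∧ w = fun i => ∫ x, a i x ∂μ})
    (hyC : y ∉ C)
    (μstar : Measure K) (hμstar : IsFiniteMeasure μstar)
    (w : Fin m → ℝ) (hw : w = fun i => ∫ x, a i x ∂μstar)
    (hmin : ∀ ν : Measure K, IsFiniteMeasure ν →
      Dbeta β y w ≤ Dbeta β y (fun i => ∫ x, a i x ∂ν)) :
    (∃ i, 0 < lamvec β y w i) ∧ (∃ i, lamvec β y w i < 0) := by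
  classical
  have hcpt : CompactSpace K := isCompact_iff_compactSpace.mp hK
  have hint : ∀ (ν : Measure K), IsFiniteMeasure ν → ∀ i, Integrable (fun x => a i x) ν := by
    intro ν hν i
    exact (a i).continuous.integrable_of_hasCompactSupport (HasCompactSupport.of_compactSpace _)
  have hw0 : ∀ i, 0 ≤ w i := by
    intro i; rw [hw]; exact integral_nonneg (ha0 i)
  -- finiteness
  choose x hx using hane
  have hxpos : ∀ i, 0 < a i (x i) := fun i => lt_of_le_of_ne (ha0 i _) (hx i).symm
  have hgood : ∀ i, Gd β (y i) (w i) := by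
    by_contra hc
    push Not at hc
    obtain ⟨i, hi⟩ := hc
    have htop := Dbeta_bad hy0 i hi
    let ν : Measure K := ∑ j, Measure.dirac (x j)
    have hν : IsFiniteMeasure ν := inferInstance
    have h1 := hmin ν hν
    have hpos : ∀ j, 0 < ∫ z, a j z ∂ν := by
      intro j
      have : ∫ z, a j z ∂ν = ∑ k, a j (x k) := by
        simp only [ν]
        rw [integral_finsetSum_measure (fun k _ => hint _ inferInstance j)]
        simp
      rw [this]
      exact lt_of_lt_of_le (hxpos j)
        (Finset.single_le_sum (f := fun k => a j (x k)) (fun k _ => ha0 j _) (Finset.mem_univ j))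
    rw [htop, Dbeta_good (fun j => ⟨fun h => ⟨(hy0 h j).ne', (hpos j).ne'⟩,
      fun _ h => (hpos j).ne' h.1⟩)] at h1
    exact absurd (top_le_iff.mp h1) (EReal.coe_ne_top _)
  have hminR : ∀ ν : Measure K, IsFiniteMeasure ν → ∀ v : Fin m → ℝ,
      (∀ i, ∫ z, a i z ∂ν = v i) → (∀ i, Gd β (y i) (v i)) →
      ∑ i, Fb β (y i) (w i) ≤ ∑ i, Fb β (y i) (v i) := by
    intro ν hν v hv hg
    have h1 := hmin ν hν
    rw [show (fun i => ∫ z, a i z ∂ν) = v from funext hv, Dbeta_good hgood, Dbeta_good hg] at h1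
    exact_mod_cast h1
  -- first-order condition along scaling
  have hsum : ∑ i, w i * lamvec β y w i = 0 := by
    have hder : HasDerivAt (fun t : ℝ => ∑ i, Fb β (y i) (t * w i))
        (∑ i, w i * lamvec β y w i) 1 := by
      apply HasDerivAt.fun_sum
      intro i _
      rcases (hw0 i).eq_or_lt with h | h
      · rw [← h]
        simpa using hasDerivAt_const (1:ℝ) (Fb β (y i) 0)
      · have h1 : HasDerivAt (fun v => Fb β (y i) v) (lamvec β y w i) (1 * w i) := by
          rw [one_mul, lamvec, if_pos h]
          exact Fb_deriv (hy i) (fun hb => hy0 hb i) h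
        have h2 : HasDerivAt (fun t : ℝ => t * w i) (1 * w i) 1 :=
          (hasDerivAt_id (1:ℝ)).mul_const (w i)
        have h3 := h1.comp (1:ℝ) h2
        refine h3.congr_deriv (by ring)
    have hloc : IsLocalMin (fun t : ℝ => ∑ i, Fb β (y i) (t * w i)) 1 := by
      filter_upwards [lt_mem_nhds (zero_lt_one' ℝ)] with t ht
      simp only [one_mul]
      refine hminR (ENNReal.ofReal t • μstar) (Measure.smul_finite _ ENNReal.ofReal_ne_top) _ ?_ ?_
      · intro i
        rw [integral_smul_measure, ENNReal.toReal_ofReal ht.le, hw, smul_eq_mul]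
      · intro i
        obtain ⟨g1, g2⟩ := hgood i
        refine ⟨fun h => ⟨(g1 h).1, mul_ne_zero ht.ne' (g1 h).2⟩, fun h h' => g2 h ⟨?_, h'.2⟩⟩
        exact (mul_eq_zero.mp h'.1).resolve_left ht.ne'
    exact hloc.hasDerivAt_eq_zero hder
  by_cases hall : ∀ i, w i * lamvec β y w i = 0
  · exfalso
    have hor : ∀ i, w i = 0 ∨ (0 < y i ∧ w i = y i) := by
      intro i
      rcases (hw0 i).eq_or_lt with h | h
      · exact Or.inl h.symm
      · right
        have h1 := (mul_eq_zero.mp (hall i)).resolve_left h.ne'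
        rw [lamvec, if_pos h] at h1
        have h2 := (mul_eq_zero.mp h1).resolve_left (Real.rpow_pos_of_pos h _).ne'
        exact ⟨by linarith, by linarith⟩
    have hex : ∃ i, w i = 0 ∧ 0 < y i := by
      by_contra hc
      push Not at hc
      apply hyC
      rw [hC]
      refine ⟨μstar, hμstar, ?_⟩
      rw [← hw]
      funext i
      rcases hor i with h | h
      · rw [h]; exact le_antisymm (hc i h) (hy i)
      · exact h.2.symm
    obtain ⟨i, hi0, hiy⟩ := hex
    have hb : 1 < β := by
      by_contra hc
      exact (hgood i).2 (not_lt.mp hc) ⟨hi0, hiy⟩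
    have hlim : ∀ j, ∃ L : ℝ, L ≤ 0 ∧ (j = i → L < 0) ∧ Filter.Tendsto (fun t : ℝ =>
        (Fb β (y j) (w j + t * a j (x i)) - Fb β (y j) (w j)) / t ^ (β - 1))
        (nhdsWithin 0 (Ioi 0)) (nhds L) := by
      intro j
      have hb' : 0 < β - 1 := by linarith
      rcases hor j with h | h
      · refine ⟨_, ?_, ?_, by rw [h]; exact Fb_rate_zero hb (ha0 j (x i))⟩
        · have := hy j
          have h2 := Real.rpow_nonneg (ha0 j (x i)) (β - 1)
          have : 0 ≤ y j * (a j (x i)) ^ (β - 1) / (β - 1) := by positivity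
          linarith
        · rintro rfl
          have h2 := Real.rpow_pos_of_pos (hxpos j) (β - 1)
          have : 0 < y j * (a j (x j)) ^ (β - 1) / (β - 1) := by positivity
          linarith
      · refine ⟨0, le_rfl, ?_, by rw [h.2]; exact Fb_rate_pos hb hβ.2 h.1⟩
        rintro rfl
        exact absurd (h.2.symm.trans hi0) h.1.ne'
    choose L hL0 hLi hL using hlim
    have hT := tendsto_finsetSum Finset.univ (fun j _ => hL j)
    have hneg : ∑ j, L j < 0 :=
      Finset.sum_neg' (fun j _ => hL0 j) ⟨i, Finset.mem_univ i, hLi i rfl⟩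
    refine absurd (ge_of_tendsto hT ?_) (not_le.mpr hneg)
    filter_upwards [self_mem_nhdsWithin] with t ht
    have ht : 0 < t := ht
    rw [← Finset.sum_div, Finset.sum_sub_distrib]
    refine div_nonneg (sub_nonneg.mpr ?_) (Real.rpow_nonneg ht.le _)
    have hfin : IsFiniteMeasure (ENNReal.ofReal t • Measure.dirac (x i)) :=
      Measure.smul_finite _ ENNReal.ofReal_ne_top
    refine hminR (μstar + ENNReal.ofReal t • Measure.dirac (x i)) inferInstance _ ?_ ?_
    · intro j
      rw [integral_add_measure (hint _ hμstar j) (hint _ hfin j), integral_smul_measure,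
        ENNReal.toReal_ofReal ht.le, hw, integral_dirac, smul_eq_mul]
    · intro j
      exact ⟨fun h => by linarith, fun h => by linarith⟩
  · push Not at hall
    obtain ⟨i, hi⟩ := hall
    constructor
    · by_contra hc
      push Not at hc
      apply hi
      exact (Finset.sum_eq_zero_iff_of_nonpos
        (fun j _ => mul_nonpos_of_nonneg_of_nonpos (hw0 j) (hc j))).mp hsum i (Finset.mem_univ i)
    · by_contra hc
      push Not at hc
      apply hi
      exact (Finset.sum_eq_zero_iff_of_nonneg
        (fun j _ => mul_nonneg (hw0 j) (hc j))).mp hsum i (Finset.mem_univ i)
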